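/- (Darboux transformation for the dpKP equation.) Let a_1, a_2, a_3 be complex numbers with a_i ≠ a_j for i ≠ j, let v : ℤ³ × ℝ → ℂ be smooth in x and satisfy the dpKP equation at every lattice point and every x, and let θ : ℤ³ × ℝ → ℂ be nowhere vanishing, smooth in x, and satisfy a_i θ_i − a_j θ_j = (v_j − v_i + a_i − a_j)θ for all 1 ≤ i < j ≤ 3 and θ_x = a_i θ_i + (v_i − v − a_i)θ for each i = 1,2,3. Then ṽ := v + θ_x/θ satisfies the dpKP equation at every lattice point and every x. -/

import Mathlib

noncomputable section

/-- Forward shift in the `i`-th discrete direction of `ℤ³`. -/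
def fwd (i : Fin 3) (n : Fin 3 → ℤ) : Fin 3 → ℤ := Function.update n i (n i + 1)

/-- Backward shift in the `i`-th discrete direction of `ℤ³`. -/
def bwd (i : Fin 3) (n : Fin 3 → ℤ) : Fin 3 → ℤ := Function.update n i (n i - 1)

/-- The discrete potential KP (dpKP) equation
`(v_2−v_1+a_1−a_2)(v_{23}−v_{12}+a_1−a_3) = (v_3−v_1+a_1−a_3)(v_{23}−v_{13}+a_1−a_2)`,
at every lattice point and every `x`. -/
def dpKP (a : Fin 3 → ℂ) (v : (Fin 3 → ℤ) → ℝ → ℂ) : Prop :=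
  ∀ n x,
    (v (fwd 1 n) x - v (fwd 0 n) x + a 0 - a 1)
        * (v (fwd 1 (fwd 2 n)) x - v (fwd 0 (fwd 1 n)) x + a 0 - a 2)
      = (v (fwd 2 n) x - v (fwd 0 n) x + a 0 - a 2)
        * (v (fwd 1 (fwd 2 n)) x - v (fwd 0 (fwd 2 n)) x + a 0 - a 1)

/-- Forward shifts in different lattice directions commute. -/
theorem fwd_comm {i j : Fin 3} (h : i ≠ j) (n : Fin 3 → ℤ) :
    fwd i (fwd j n) = fwd j (fwd i n) := by
  simp only [fwd, Function.update_of_ne h, Function.update_of_ne h.symm]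
  exact Function.update_comm h.symm _ _ _

/-- Under the Darboux transformation, the difference `v_j − v_i + a_i − a_j` is multiplied by
`θ θ_{ij} / (θ_i θ_j)`. -/
theorem darboux_difference
    {a : Fin 3 → ℂ} {v θ : (Fin 3 → ℤ) → ℝ → ℂ}
    (hθ0 : ∀ n x, θ n x ≠ 0)
    (hθd : ∀ i j : Fin 3, i < j → ∀ n x,
      a i * θ (fwd i n) x - a j * θ (fwd j n) x
        = (v (fwd j n) x - v (fwd i n) x + a i - a j) * θ n x)
    (hθx : ∀ i : Fin 3, ∀ n x,
      deriv (θ n) x = a i * θ (fwd i n) x + (v (fwd i n) x - v n x - a i) * θ n x)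
    {i j : Fin 3} (hij : i < j) (n : Fin 3 → ℤ) (x : ℝ) :
    (v (fwd j n) x + deriv (θ (fwd j n)) x / θ (fwd j n) x)
        - (v (fwd i n) x + deriv (θ (fwd i n)) x / θ (fwd i n) x) + a i - a j
      = θ n x * θ (fwd i (fwd j n)) x / (θ (fwd i n) x * θ (fwd j n) x)
        * (v (fwd j n) x - v (fwd i n) x + a i - a j) := by
  have hi := hθ0 (fwd i n) x
  have hj := hθ0 (fwd j n) x
  rw [hθx i (fwd j n) x, hθx j (fwd i n) x, fwd_comm hij.ne' n]
  field_simp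
  linear_combination θ (fwd i (fwd j n)) x * hθd i j hij n x

/-- Darboux transformation for the dpKP equation: if `v` solves dpKP and `θ` is a
nowhere-vanishing solution of the associated linear system
`a_i θ_i − a_j θ_j = (v_j − v_i + a_i − a_j)θ`, `θ_x = a_i θ_i + (v_i − v − a_i)θ`, then
`ṽ = v + θ_x/θ` solves the dpKP equation. -/
theorem darboux_dpKP
    (a : Fin 3 → ℂ) (ha : ∀ i j : Fin 3, i ≠ j → a i ≠ a j)
    (v θ : (Fin 3 → ℤ) → ℝ → ℂ)
    (hvsmooth : ∀ n, ContDiff ℝ (⊤ : ℕ∞) (v n))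
    (hv : dpKP a v)
    (hθ0 : ∀ n x, θ n x ≠ 0)
    (hθsmooth : ∀ n, ContDiff ℝ (⊤ : ℕ∞) (θ n))
    (hθd : ∀ i j : Fin 3, i < j → ∀ n x,
      a i * θ (fwd i n) x - a j * θ (fwd j n) x
        = (v (fwd j n) x - v (fwd i n) x + a i - a j) * θ n x)
    (hθx : ∀ i : Fin 3, ∀ n x,
      deriv (θ n) x = a i * θ (fwd i n) x + (v (fwd i n) x - v n x - a i) * θ n x) :
    dpKP a (fun n x => v n x + deriv (θ n) x / θ n x) := by
  intro n x
  have key := @darboux_difference a v θ hθ0 hθd hθx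
  have h01 : (0 : Fin 3) < 1 := by decide
  have h02 : (0 : Fin 3) < 2 := by decide
  have e12 : fwd 2 (fwd 1 n) = fwd 1 (fwd 2 n) := fwd_comm (by decide) n
  have k1 := key h02 (fwd 1 n) x
  rw [e12] at k1
  beta_reduce
  rw [key h01 n x, key h02 n x, k1, key h01 (fwd 2 n) x]
  have h1 := hθ0 (fwd 0 n) x
  have h2 := hθ0 (fwd 1 n) x
  have h3 := hθ0 (fwd 2 n) x
  have h12 := hθ0 (fwd 0 (fwd 1 n)) x
  have h13 := hθ0 (fwd 0 (fwd 2 n)) x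
  have h23 := hθ0 (fwd 1 (fwd 2 n)) x
  have hvn := hv n x
  field_simp
  linear_combination θ n x * θ (fwd 0 (fwd 1 (fwd 2 n))) x * hvn
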